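/- Monotonicity of Δ_P under discarding ancilla: Δ_P(XA₁:A₂:⋯:Aₙ) ≥ Δ_P(A₁:A₂:⋯:Aₙ) for any state ρ_{XA₁⋯Aₙ}. -/

import Mathlib

open scoped BigOperators ComplexOrder

noncomputable section

/-- Von Neumann entropy of a matrix: `−∑ λᵢ log λᵢ` over its eigenvalues
(defined to be `0` if the matrix is not Hermitian). -/
noncomputable def matEntropy {ι : Type} [Fintype ι] [DecidableEq ι]
    (ρ : Matrix ι ι ℂ) : ℝ :=
  if h : ρ.IsHermitian then ∑ i, Real.negMulLog (h.eigenvalues i) else 0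

/-- A density matrix: positive semidefinite with unit trace. -/
def IsDensityMatrix {ι : Type} [Fintype ι] (ρ : Matrix ι ι ℂ) : Prop :=
  ρ.PosSemidef ∧ ρ.trace = 1

instance sumElimFintype {κ π : Type} {α : κ → Type} {δ : π → Type}
    [∀ i, Fintype (α i)] [∀ k, Fintype (δ k)] :
    ∀ i : κ ⊕ π, Fintype (Sum.elim α δ i)
  | .inl a => inferInstanceAs (Fintype (α a))
  | .inr b => inferInstanceAs (Fintype (δ b))

instance sumElimDecEq {κ π : Type} {α : κ → Type} {δ : π → Type}
    [∀ i, DecidableEq (α i)] [∀ k, DecidableEq (δ k)] :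
    ∀ i : κ ⊕ π, DecidableEq (Sum.elim α δ i)
  | .inl a => inferInstanceAs (DecidableEq (α a))
  | .inr b => inferInstanceAs (DecidableEq (δ b))

/-- Reduced density matrix on the subsystems in `s` (partial trace over the rest). -/
noncomputable def reduce {κ : Type} [Fintype κ] [DecidableEq κ] {α : κ → Type}
    [∀ i, Fintype (α i)] (s : Finset κ)
    (ρ : Matrix (∀ i, α i) (∀ i, α i) ℂ) :
    Matrix (∀ i : {j // j ∈ s}, α i.1) (∀ i : {j // j ∈ s}, α i.1) ℂ :=
  Matrix.of fun f g => ∑ h : ∀ i : {j // j ∉ s}, α i.1,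
    ρ (fun i => if hi : i ∈ s then f ⟨i, hi⟩ else h ⟨i, hi⟩)
      (fun i => if hi : i ∈ s then g ⟨i, hi⟩ else h ⟨i, hi⟩)

/-- The (pure) density matrix `|ψ⟩⟨ψ|` of a state vector. -/
def vecState {ι : Type} (ψ : ι → ℂ) : Matrix ι ι ℂ :=
  Matrix.of fun x y => ψ x * star (ψ y)

/-- Multipartite mutual information `∑ᵢ S_{Aᵢ} − S_{A₁⋯Aₙ}`. -/
noncomputable def Imulti {κ : Type} [Fintype κ] [DecidableEq κ] {α : κ → Type}
    [∀ i, Fintype (α i)] [∀ i, DecidableEq (α i)]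
    (ρ : Matrix (∀ i, α i) (∀ i, α i) ℂ) : ℝ :=
  (∑ i, matEntropy (reduce {i} ρ)) - matEntropy ρ

/-- Merge an assignment on the original systems with one on the ancillas. -/
def mergeSum {κ π : Type} {α : κ → Type} {δ : π → Type}
    (f : ∀ i, α i) (h : ∀ k, δ k) : ∀ i : κ ⊕ π, Sum.elim α δ i
  | .inl a => f a
  | .inr b => h b

/-- The subsystems belonging to party `k` together with its ancilla. -/
def partyFinset {κ π : Type} [Fintype κ] [DecidableEq κ] [DecidableEq π]
    (p : κ → π) (k : π) : Finset (κ ⊕ π) :=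
  (Finset.univ.filter fun i => p i = k).image Sum.inl ∪ {Sum.inr k}

/-- `ψ` (on the original systems plus one ancilla `Fin (d k)` per party)
purifies `ρ`: tracing out all ancillas from `|ψ⟩⟨ψ|` gives back `ρ`. -/
def Purifies {κ π : Type} [Fintype κ] {α : κ → Type} [∀ i, Fintype (α i)]
    [Fintype π] [DecidableEq π] {d : π → ℕ}
    (ψ : (∀ i : κ ⊕ π, Sum.elim α (fun k => Fin (d k)) i) → ℂ)
    (ρ : Matrix (∀ i, α i) (∀ i, α i) ℂ) : Prop :=
  ∀ f g, (∑ h : ∀ k, Fin (d k), vecState ψ (mergeSum f h) (mergeSum g h)) = ρ f g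

/-- Multipartite entanglement of purification for the partition of the systems `κ`
into parties `π` given by `p`: the infimum over all purifications (with one ancilla
per party, of arbitrary finite dimension) of `∑ₖ S_{AₖAₖ'}`. -/
noncomputable def DeltaPart {κ π : Type} [Fintype κ] [DecidableEq κ]
    [Fintype π] [DecidableEq π] {α : κ → Type}
    [∀ i, Fintype (α i)] [∀ i, DecidableEq (α i)]
    (p : κ → π) (ρ : Matrix (∀ i, α i) (∀ i, α i) ℂ) : ℝ :=
  sInf { x | ∃ (d : π → ℕ) (ψ : (∀ i : κ ⊕ π, Sum.elim α (fun k => Fin (d k)) i) → ℂ),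
    Purifies ψ ρ ∧
    x = ∑ k : π, matEntropy (reduce (partyFinset p k) (vecState ψ)) }

/-- Bipartite-style entanglement of purification for the partition `p`:
the infimum over purifications of the entropy of the single party `k₀`
together with its ancilla. -/
noncomputable def EPart {κ π : Type} [Fintype κ] [DecidableEq κ]
    [Fintype π] [DecidableEq π] {α : κ → Type}
    [∀ i, Fintype (α i)] [∀ i, DecidableEq (α i)]
    (p : κ → π) (k₀ : π) (ρ : Matrix (∀ i, α i) (∀ i, α i) ℂ) : ℝ :=
  sInf { x | ∃ (d : π → ℕ) (ψ : (∀ i : κ ⊕ π, Sum.elim α (fun k => Fin (d k)) i) → ℂ),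
    Purifies ψ ρ ∧
    x = matEntropy (reduce (partyFinset p k₀) (vecState ψ)) }

theorem matEntropy_submatrix_equiv {ι ι' : Type} [Fintype ι] [DecidableEq ι]
    [Fintype ι'] [DecidableEq ι'] (e : ι' ≃ ι) (M : Matrix ι ι ℂ) :
    matEntropy (M.submatrix e e) = matEntropy M := by
  have hM : (M.submatrix e e).IsHermitian ↔ M.IsHermitian :=
    Matrix.isHermitian_submatrix_equiv e
  have sum_eq : ∀ {ι : Type} [Fintype ι] [DecidableEq ι] {A : Matrix ι ι ℂ}
      (h : A.IsHermitian), ∑ i, Real.negMulLog (h.eigenvalues i)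
        = (A.charpoly.roots.map fun z => Real.negMulLog z.re).sum := by
    intro ι _ _ A h
    simp [h.roots_charpoly_eq_eigenvalues, Multiset.map_map]
  unfold matEntropy
  by_cases h : M.IsHermitian
  · rw [dif_pos h, dif_pos (hM.2 h), sum_eq, sum_eq]
    have hc : (M.submatrix e e).charpoly = M.charpoly := Matrix.charpoly_reindex e.symm M
    rw [hc]
  · rw [dif_neg h, dif_neg (mt hM.1 h)]

theorem IsDensityMatrix.matEntropy_nonneg {ι : Type} [Fintype ι] [DecidableEq ι]
    {ρ : Matrix ι ι ℂ} (hρ : IsDensityMatrix ρ) : 0 ≤ matEntropy ρ := by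
  obtain ⟨hpos, htr⟩ := hρ
  have hsum : ∑ i, hpos.1.eigenvalues i = 1 := by
    have := hpos.1.trace_eq_sum_eigenvalues
    rw [htr] at this
    exact Complex.ofReal_injective (by simpa using this.symm)
  rw [matEntropy, dif_pos hpos.1]
  refine Finset.sum_nonneg fun i _ => Real.negMulLog_nonneg (hpos.eigenvalues_nonneg i) ?_
  rw [← hsum]
  exact Finset.single_le_sum (fun j _ => hpos.eigenvalues_nonneg j) (Finset.mem_univ i)

theorem posSemidef_vecState {ι : Type} [Finite ι] (ψ : ι → ℂ) : (vecState ψ).PosSemidef :=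
  Matrix.posSemidef_vecMulVec_self_star ψ

section Reduce

variable {κ : Type} [Fintype κ] [DecidableEq κ] {α : κ → Type} [∀ i, Fintype (α i)]

theorem reduce_eq_sum_submatrix (s : Finset κ) (ρ : Matrix (∀ i, α i) (∀ i, α i) ℂ) :
    reduce s ρ = ∑ h : ∀ i : {j // j ∉ s}, α i.1,
      ρ.submatrix (fun f => (Equiv.piEquivPiSubtypeProd (· ∈ s) α).symm (f, h))
        (fun f => (Equiv.piEquivPiSubtypeProd (· ∈ s) α).symm (f, h)) := by
  ext f g
  simp only [reduce, Matrix.of_apply, Matrix.sum_apply, Matrix.submatrix_apply]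
  rfl

theorem trace_reduce (s : Finset κ) (ρ : Matrix (∀ i, α i) (∀ i, α i) ℂ) :
    (reduce s ρ).trace = ρ.trace := by
  simp only [Matrix.trace, Matrix.diag, reduce_eq_sum_submatrix, Matrix.sum_apply,
    Matrix.submatrix_apply]
  rw [← Fintype.sum_prod_type' (f := fun f h =>
    ρ ((Equiv.piEquivPiSubtypeProd (· ∈ s) α).symm (f, h))
      ((Equiv.piEquivPiSubtypeProd (· ∈ s) α).symm (f, h)))]
  exact Equiv.sum_comp (Equiv.piEquivPiSubtypeProd (· ∈ s) α).symm fun x => ρ x x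

theorem IsDensityMatrix.reduce {ρ : Matrix (∀ i, α i) (∀ i, α i) ℂ}
    (hρ : IsDensityMatrix ρ) (s : Finset κ) : IsDensityMatrix (reduce s ρ) := by
  refine ⟨?_, (trace_reduce s ρ).trans hρ.2⟩
  rw [reduce_eq_sum_submatrix]
  exact Matrix.posSemidef_sum _ fun h _ => hρ.1.submatrix _

end Reduce

section Purifies

variable {κ π : Type} [Fintype κ] [DecidableEq κ] [Fintype π] [DecidableEq π]
  {α : κ → Type} [∀ i, Fintype (α i)]

theorem Purifies.isDensityMatrix_vecState {d : π → ℕ}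
    {ψ : (∀ i : κ ⊕ π, Sum.elim α (fun k => Fin (d k)) i) → ℂ}
    {ρ : Matrix (∀ i, α i) (∀ i, α i) ℂ} (hψ : Purifies ψ ρ) (hρ : IsDensityMatrix ρ) :
    IsDensityMatrix (vecState ψ) := by
  refine ⟨posSemidef_vecState ψ, ?_⟩
  rw [← hρ.2, Matrix.trace, Matrix.trace,
    ← Equiv.sum_comp (Equiv.sumPiEquivProdPi (Sum.elim α fun k => Fin (d k))).symm,
    Fintype.sum_prod_type]
  refine Finset.sum_congr rfl fun f _ => ?_
  refine Eq.trans (Finset.sum_congr rfl fun h _ => ?_) (hψ f f)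
  have : (Equiv.sumPiEquivProdPi (Sum.elim α fun k => Fin (d k))).symm (f, h)
      = mergeSum f h := by
    funext i
    cases i <;> rfl
  rw [Matrix.diag_apply, this]
  rfl

theorem exists_purifies [Nonempty π] {ρ : Matrix (∀ i, α i) (∀ i, α i) ℂ}
    (hρ : ρ.PosSemidef) :
    ∃ (d : π → ℕ) (ψ : (∀ i : κ ⊕ π, Sum.elim α (fun k => Fin (d k)) i) → ℂ),
      Purifies ψ ρ := by
  classical
  open scoped MatrixOrder Matrix.Norms.L2Operator in
  obtain ⟨B, hB⟩ := CStarAlgebra.nonneg_iff_eq_mul_star_self.mp hρ.nonneg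
  obtain ⟨k₀⟩ := ‹Nonempty π›
  let d : π → ℕ := fun k => if k = k₀ then Fintype.card (∀ i, α i) else 1
  let ε : (∀ k, Fin (d k)) ≃ ∀ i, α i :=
    Fintype.equivOfCardEq (by rw [Fintype.card_pi]; simp [d])
  refine ⟨d, fun x => B (fun i => x (.inl i)) (ε fun k => x (.inr k)), fun f g => ?_⟩
  rw [hB, Matrix.mul_apply, ← Equiv.sum_comp ε]
  rfl

end Purifies

section Regroup

variable {K K' : Type} {β : K → Type} {β' : K' → Type}

/-- Unfold every coarse system `i'` into the fine systems in its fibre under `r`. -/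
def unfoldFibres (r : K → K') (e : ∀ i', β' i' ≃ ∀ i : {i // r i = i'}, β i)
    (x : ∀ i', β' i') : ∀ i, β i :=
  fun i => e (r i) (x (r i)) ⟨i, rfl⟩

theorem unfoldFibres_apply (r : K → K') (e : ∀ i', β' i' ≃ ∀ i : {i // r i = i'}, β i)
    (x : ∀ i', β' i') {i : K} {i' : K'} (h : r i = i') :
    unfoldFibres r e x i = e i' (x i') ⟨i, h⟩ := by
  subst h
  rfl

/-- Assignments on a set of coarse systems are assignments on its preimage. -/
def unfoldFibresOn (r : K → K') (e : ∀ i', β' i' ≃ ∀ i : {i // r i = i'}, β i)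
    {P : K → Prop} {P' : K' → Prop} (hP : ∀ i, P i ↔ P' (r i)) :
    (∀ i' : {i' // P' i'}, β' i') ≃ (∀ i : {i // P i}, β i) where
  toFun x i := e (r i) (x ⟨r i, (hP i).1 i.2⟩) ⟨i, rfl⟩
  invFun y i' := (e i').symm fun i => y ⟨i, (hP i).2 (i.2.symm ▸ i'.2)⟩
  left_inv x := by
    funext ⟨i', hi'⟩
    rw [Equiv.symm_apply_eq]
    funext ⟨i, hi⟩
    dsimp only at hi
    subst hi
    rfl
  right_inv y := by
    funext i
    simp

theorem matEntropy_reduce_unfoldFibres [Fintype K] [DecidableEq K] [Fintype K'] [DecidableEq K']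
    [∀ i, Fintype (β i)] [∀ i, DecidableEq (β i)]
    [∀ i, Fintype (β' i)] [∀ i, DecidableEq (β' i)]
    (r : K → K') (e : ∀ i', β' i' ≃ ∀ i : {i // r i = i'}, β i)
    (M : Matrix (∀ i, β i) (∀ i, β i) ℂ) {s : Finset K} {s' : Finset K'}
    (hs : ∀ i, i ∈ s ↔ r i ∈ s') :
    matEntropy (reduce s' (M.submatrix (unfoldFibres r e) (unfoldFibres r e)))
      = matEntropy (reduce s M) := by
  rw [← matEntropy_submatrix_equiv (unfoldFibresOn r e hs) (reduce s M)]
  congr 1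
  ext f g
  simp only [reduce, Matrix.of_apply, Matrix.submatrix_apply]
  have hs' : ∀ i, i ∉ s ↔ r i ∉ s' := fun i => not_congr (hs i)
  rw [← Equiv.sum_comp (unfoldFibresOn r e (P := (· ∉ s)) (P' := (· ∉ s')) hs')]
  have glue : ∀ (f : ∀ i : {i // i ∈ s'}, β' i) (h : ∀ i : {i // i ∉ s'}, β' i),
      unfoldFibres r e (fun i => if hi : i ∈ s' then f ⟨i, hi⟩ else h ⟨i, hi⟩)
        = fun i => if hi : i ∈ s then unfoldFibresOn r e hs f ⟨i, hi⟩
          else unfoldFibresOn r e (P := (· ∉ s)) (P' := (· ∉ s')) hs' h ⟨i, hi⟩ := by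
    intro f h
    funext i
    by_cases hi : i ∈ s
    · have hi' := (hs i).1 hi
      simp [unfoldFibres, unfoldFibresOn, hi, hi']
    · have hi' := mt (hs i).2 hi
      simp [unfoldFibres, unfoldFibresOn, hi, hi']
  simp only [glue]

end Regroup

section Discard

variable {κ π π' : Type} [DecidableEq κ]

/-- Discarded systems, and all ancillas, are assigned to the ancilla of their party. -/
def absorb (σ : Finset κ) (p : κ → π) (ε : π ≃ π') : κ ⊕ π → {i // i ∈ σ} ⊕ π'
  | .inl i => if h : i ∈ σ then .inl ⟨i, h⟩ else .inr (ε (p i))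
  | .inr k => .inr (ε k)

theorem absorb_inl_of_mem {σ : Finset κ} (p : κ → π) (ε : π ≃ π') {i : κ} (h : i ∈ σ) :
    absorb σ p ε (.inl i) = .inl ⟨i, h⟩ := dif_pos h

theorem absorb_inl_of_notMem {σ : Finset κ} (p : κ → π) (ε : π ≃ π') {i : κ} (h : i ∉ σ) :
    absorb σ p ε (.inl i) = .inr (ε (p i)) := dif_neg h

theorem absorb_eq_inl_iff {σ : Finset κ} (p : κ → π) (ε : π ≃ π') {x : κ ⊕ π}
    {j : {i // i ∈ σ}} : absorb σ p ε x = .inl j ↔ x = .inl j.1 := by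
  obtain ⟨j, hj⟩ := j
  rcases x with i | k
  · by_cases h : i ∈ σ
    · simp [absorb_inl_of_mem p ε h]
    · simp only [absorb_inl_of_notMem p ε h, Sum.inl.injEq, reduceCtorEq, false_iff]
      rintro rfl
      exact h hj
  · simp [absorb]

theorem mem_partyFinset {κ π : Type} [Fintype κ] [DecidableEq κ] [DecidableEq π]
    {p : κ → π} {k : π} {x : κ ⊕ π} : x ∈ partyFinset p k ↔ Sum.elim p id x = k := by
  cases x <;> simp [partyFinset]

theorem mem_partyFinset_absorb [Fintype κ] [DecidableEq π] [DecidableEq π']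
    {σ : Finset κ} {p : κ → π} {ε : π ≃ π'} {p' : {i // i ∈ σ} → π'}
    (hp : ∀ j, p' j = ε (p j)) (k : π) (x : κ ⊕ π) :
    x ∈ partyFinset p k ↔ absorb σ p ε x ∈ partyFinset p' (ε k) := by
  rw [mem_partyFinset, mem_partyFinset]
  rcases x with i | l
  · by_cases h : i ∈ σ
    · simp [absorb_inl_of_mem p ε h, hp]
    · simp [absorb_inl_of_notMem p ε h]
  · simp [absorb]

variable [Fintype κ] [Fintype π]

/-- Dimension of the ancilla of a party after it has absorbed the discarded systems. -/
def absorbDim (α : κ → Type) (σ : Finset κ) (p : κ → π) (ε : π ≃ π') (d : π → ℕ)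
    (k' : π') : ℕ :=
  Nat.card (∀ x : {x // absorb σ p ε x = .inr k'}, Sum.elim α (fun k => Fin (d k)) x.1)

/-- An enlarged ancilla is the composite of the old systems assigned to it. -/
def ancillaEquiv (α : κ → Type) [∀ i, Fintype (α i)] (σ : Finset κ) (p : κ → π)
    (ε : π ≃ π') (d : π → ℕ) (k' : π') :
    Fin (absorbDim α σ p ε d k')
      ≃ ∀ x : {x // absorb σ p ε x = .inr k'}, Sum.elim α (fun k => Fin (d k)) x.1 :=
  (Finite.equivFin _).symm

/-- Each new system is the composite of the old systems it has absorbed. -/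
def absorbEquiv (α : κ → Type) [∀ i, Fintype (α i)] (σ : Finset κ) (p : κ → π)
    (ε : π ≃ π') (d : π → ℕ) :
    ∀ x', Sum.elim (fun j : {i // i ∈ σ} => α j) (fun k' => Fin (absorbDim α σ p ε d k')) x'
      ≃ ∀ x : {x // absorb σ p ε x = x'}, Sum.elim α (fun k => Fin (d k)) x.1
  | .inl j =>
    { toFun := fun a x => cast (by rw [(absorb_eq_inl_iff p ε).1 x.2]; rfl) a
      invFun := fun y => y ⟨.inl j.1, (absorb_eq_inl_iff p ε).2 rfl⟩
      left_inv := fun a => rfl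
      right_inv := fun y => by
        funext ⟨x, hx⟩
        obtain rfl := (absorb_eq_inl_iff p ε).1 hx
        rfl }
  | .inr k' => ancillaEquiv α σ p ε d k'

/-- The values of an absorbed ancilla assignment on the discarded systems and on the
original ancillas. -/
def absorbedEquiv (α : κ → Type) [∀ i, Fintype (α i)] (σ : Finset κ) (p : κ → π)
    (ε : π ≃ π') (d : π → ℕ) (f : ∀ j : {i // i ∈ σ}, α j) :
    (∀ k', Fin (absorbDim α σ p ε d k')) ≃
      (∀ i : {i // i ∉ σ}, α i) × (∀ k, Fin (d k)) where
  toFun h' :=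
    (fun i => ancillaEquiv α σ p ε d (ε (p i)) (h' _)
        ⟨.inl i.1, absorb_inl_of_notMem p ε i.2⟩,
      fun k => ancillaEquiv α σ p ε d (ε k) (h' _) ⟨.inr k, rfl⟩)
  invFun h k' := (ancillaEquiv α σ p ε d k').symm fun x =>
    mergeSum ((Equiv.piEquivPiSubtypeProd (· ∈ σ) α).symm (f, h.1)) h.2 x.1
  left_inv h' := by
    funext k'
    rw [Equiv.symm_apply_eq]
    funext ⟨x, hx⟩
    rcases x with i | k
    · by_cases hi : i ∈ σ
      · simp [absorb_inl_of_mem p ε hi] at hx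
      · obtain rfl : ε (p i) = k' := by simpa [absorb_inl_of_notMem p ε hi] using hx
        exact dif_neg hi
    · obtain rfl : ε k = k' := by simpa [absorb] using hx
      rfl
  right_inv h := by
    refine Prod.ext (funext fun ⟨i, hi⟩ => ?_) (funext fun k => ?_)
    · simp only [Equiv.apply_symm_apply]
      exact dif_neg hi
    · simp only [Equiv.apply_symm_apply]
      rfl

variable {α : κ → Type} [∀ i, Fintype (α i)]

theorem unfoldFibres_mergeSum (σ : Finset κ) (p : κ → π) (ε : π ≃ π') (d : π → ℕ)
    (f₀ f : ∀ j : {i // i ∈ σ}, α j) (h' : ∀ k', Fin (absorbDim α σ p ε d k')) :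
    unfoldFibres (absorb σ p ε) (absorbEquiv α σ p ε d) (mergeSum f h')
      = mergeSum ((Equiv.piEquivPiSubtypeProd (· ∈ σ) α).symm
          (f, (absorbedEquiv α σ p ε d f₀ h').1)) (absorbedEquiv α σ p ε d f₀ h').2 := by
  funext x
  rcases x with i | k
  · by_cases hi : i ∈ σ
    · rw [unfoldFibres_apply _ _ _ (absorb_inl_of_mem p ε hi)]
      exact Eq.symm ((dif_pos hi).trans rfl)
    · rw [unfoldFibres_apply _ _ _ (absorb_inl_of_notMem p ε hi)]
      exact Eq.symm ((dif_neg hi).trans rfl)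
  · rfl

variable [DecidableEq π] [Fintype π'] [DecidableEq π']

/-- A purification of `ρ` purifies each marginal of `ρ`, the discarded systems being
absorbed into the ancillas. -/
theorem Purifies.reduce {d : π → ℕ}
    {ψ : (∀ i : κ ⊕ π, Sum.elim α (fun k => Fin (d k)) i) → ℂ}
    {ρ : Matrix (∀ i, α i) (∀ i, α i) ℂ} (hψ : Purifies ψ ρ)
    (σ : Finset κ) (p : κ → π) (ε : π ≃ π') :
    Purifies (ψ ∘ unfoldFibres (absorb σ p ε) (absorbEquiv α σ p ε d)) (reduce σ ρ) := by
  intro f g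
  simp only [reduce_eq_sum_submatrix, Matrix.sum_apply, Matrix.submatrix_apply, ← hψ _ _]
  rw [← Fintype.sum_prod_type', ← Equiv.sum_comp (absorbedEquiv α σ p ε d f)]
  refine Finset.sum_congr rfl fun h' _ => ?_
  simp only [vecState, Matrix.of_apply, Function.comp_apply]
  rw [unfoldFibres_mergeSum σ p ε d f f, unfoldFibres_mergeSum σ p ε d f g]

/-- Discarding subsystems does not increase the multipartite entanglement of purification. -/
theorem DeltaPart_reduce_le [∀ i, DecidableEq (α i)] [Nonempty π]
    {ρ : Matrix (∀ i, α i) (∀ i, α i) ℂ} (hρ : IsDensityMatrix ρ)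
    (σ : Finset κ) (p : κ → π) (ε : π ≃ π') (p' : {i // i ∈ σ} → π')
    (hp : ∀ j, p' j = ε (p j)) :
    DeltaPart p' (reduce σ ρ) ≤ DeltaPart p ρ := by
  refine csInf_le_csInf ⟨0, ?_⟩ ?_ ?_
  · rintro _ ⟨d, ψ, hψ, rfl⟩
    exact Finset.sum_nonneg fun k _ =>
      ((hψ.isDensityMatrix_vecState (hρ.reduce σ)).reduce _).matEntropy_nonneg
  · obtain ⟨d, ψ, hψ⟩ := exists_purifies (π := π) hρ.1
    exact ⟨_, d, ψ, hψ, rfl⟩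
  · rintro _ ⟨d, ψ, hψ, rfl⟩
    refine ⟨absorbDim α σ p ε d, _, hψ.reduce σ p ε, ?_⟩
    rw [← Equiv.sum_comp ε]
    exact Finset.sum_congr rfl fun k _ =>
      (matEntropy_reduce_unfoldFibres (absorb σ p ε) (absorbEquiv α σ p ε d) (vecState ψ)
        (mem_partyFinset_absorb hp k)).symm

end Discard

/-- monotonicity of `Δ_P` under discarding the ancilla `X`:
`Δ_P(XA₁:A₂:⋯:Aₙ) ≥ Δ_P(A₁:A₂:⋯:Aₙ)`.
The subsystems are indexed by `Fin (n+2)`: `X` is subsystem `0` and the parties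
`A₁,…,A_{n+1}` are subsystems `1,…,n+1`.  On the left, `X` and `A₁` are grouped
into a single party (the partition sends subsystem `i` to party `i−1`, with both
`0` and `1` going to party `0`); on the right `X` has been traced out. -/
theorem DeltaP_monotone {n : ℕ} {α : Fin (n + 2) → Type}
    [∀ i, Fintype (α i)] [∀ i, DecidableEq (α i)]
    (ρ : Matrix (∀ i, α i) (∀ i, α i) ℂ) (hρ : IsDensityMatrix ρ) :
    DeltaPart id (reduce (({0} : Finset (Fin (n + 2)))ᶜ) ρ)
    ≤ DeltaPart
        (fun i : Fin (n + 2) => (⟨(i : ℕ) - 1, by have := i.isLt; omega⟩ : Fin (n + 1)))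
        ρ := by
  have hle : ∀ i : Fin (n + 2), (i : ℕ) - 1 < n + 1 := fun i => by omega
  let ε : Fin (n + 1) ≃ {i : Fin (n + 2) // i ∈ ({0} : Finset (Fin (n + 2)))ᶜ} :=
    { toFun := fun k => ⟨k.succ, by simp⟩
      invFun := fun i => ⟨(i.1 : ℕ) - 1, hle i.1⟩
      left_inv := fun k => by simp
      right_inv := fun ⟨i, hi⟩ => by
        have : (i : ℕ) ≠ 0 := fun h => by simp [Fin.ext_iff, h] at hi
        ext
        simp
        omega }
  exact DeltaPart_reduce_le hρ _ _ ε id fun j => (ε.apply_symm_apply j).symm
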